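/- arXiv:2207.00281 — 9 statements merged into one kernel-verified Lean document; each statement's English description precedes it below -/
import Mathlib

section
/- Let (L, [·,·]) be a complex Lie algebra whose Lie bracket is not identically zero, and suppose that every 1/2-derivation of L is a scalar multiple of the identity map. Then every transposed Poisson structure on L is trivial: every commutative associative ℂ-bilinear multiplication · on L satisfying 2 z·[x,y] = [z·x, y] + [x, z·y] for all x, y, z ∈ L is identically zero. -/
/-- If every `1/2`-derivation of a complex Lie algebra `L` with nonzero bracket is a scalar
multiple of the identity, then every transposed Poisson structure on `L` is trivial. -/
theorem stmt_0 (L : Type*) [LieRing L] [LieAlgebra ℂ L]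
    (hbracket : ∃ x y : L, ⁅x, y⁆ ≠ 0)
    (hhalf : ∀ φ : L →ₗ[ℂ] L,
      (∀ x y : L, φ ⁅x, y⁆ = (1 / 2 : ℂ) • (⁅φ x, y⁆ + ⁅x, φ y⁆)) →
      ∃ c : ℂ, φ = c • (LinearMap.id : L →ₗ[ℂ] L))
    (mul : L →ₗ[ℂ] L →ₗ[ℂ] L)
    (hcomm : ∀ x y : L, mul x y = mul y x)
    (hassoc : ∀ x y z : L, mul (mul x y) z = mul x (mul y z))
    (hcompat : ∀ x y z : L, (2 : ℂ) • mul z ⁅x, y⁆ = ⁅mul z x, y⁆ + ⁅x, mul z y⁆) :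
    ∀ x y : L, mul x y = 0 := by
  have key : ∀ z : L, ∃ c : ℂ, ∀ y, mul z y = c • y := by
    intro z
    obtain ⟨c, hc⟩ := hhalf (mul z) (by
      intro x y
      rw [← hcompat x y z, smul_smul]
      norm_num)
    exact ⟨c, fun y => by rw [hc]; simp⟩
  choose c hc using key
  intro z w
  by_cases h : c z = 0
  · rw [hc, h, zero_smul]
  exfalso
  have hy : ∀ y : L, y = ((c z)⁻¹ * c y) • z := by
    intro y
    have h1 : c z • y = c y • z := by rw [← hc, ← hc, hcomm]
    rw [mul_smul, ← h1, smul_smul, inv_mul_cancel₀ h, one_smul]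
  obtain ⟨x, y, hxy⟩ := hbracket
  apply hxy
  rw [hy x, hy y, smul_lie, lie_smul, lie_self, smul_zero, smul_zero]
end

section
/- Let A be a finite-dimensional semisimple commutative unital associative ℂ-algebra. Then every transposed Poisson structure on A is trivial: every ℂ-bilinear Lie bracket [·,·] on A satisfying the compatibility condition 2 z·[x,y] = [z·x, y] + [x, z·y] for all x, y, z ∈ A is identically zero. -/
theorem aux_der {A : Type*} [CommRing A] [Algebra ℂ A]
    [FiniteDimensional ℂ A] [IsReduced A] (D : Derivation ℂ A A) (a : A) : D a = 0 := by
  have hint : IsIntegral ℂ a := Algebra.IsIntegral.isIntegral a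
  have hp0 : minpoly ℂ a ≠ 0 := minpoly.ne_zero hint
  have hsq : Squarefree (minpoly ℂ a) := by
    rintro q ⟨r, hr⟩
    have h1 : Polynomial.aeval a (q * r) = 0 := by
      apply eq_zero_of_pow_eq_zero (n := 2)
      have h2 : (q * r) ^ 2 = minpoly ℂ a * r := by rw [hr]; ring
      rw [← map_pow, h2, map_mul, minpoly.aeval, zero_mul]
    obtain ⟨s, hs⟩ := minpoly.dvd ℂ a h1
    have hqr : q * r ≠ 0 := by
      intro h
      apply hp0
      rw [hr, mul_assoc, h, mul_zero]
    apply IsUnit.of_mul_eq_one s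
    apply mul_left_cancel₀ hqr
    rw [mul_one]
    conv_rhs => rw [hs, hr]
    ring
  have hsep : (minpoly ℂ a).Separable := PerfectField.separable_iff_squarefree.mpr hsq
  obtain ⟨u, v, huv⟩ := hsep
  have h3 := congrArg (Polynomial.aeval a) huv
  simp only [map_add, map_mul, minpoly.aeval, mul_zero, zero_add, map_one] at h3
  have h4 : Polynomial.aeval a (Polynomial.derivative (minpoly ℂ a)) * D a = 0 := by
    have := D.map_aeval (minpoly ℂ a) a
    rw [minpoly.aeval, map_zero] at this
    simpa using this.symm
  calc D a = 1 * D a := (one_mul _).symm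
    _ = 0 := by rw [← h3, mul_assoc, h4, mul_zero]

/-- Every transposed Poisson structure on a finite-dimensional semisimple commutative unital
associative ℂ-algebra is trivial. -/
theorem stmt_3 (A : Type*) [CommRing A] [Algebra ℂ A]
    [FiniteDimensional ℂ A] [IsSemisimpleRing A]
    (bra : A →ₗ[ℂ] A →ₗ[ℂ] A)
    (hanti : ∀ x y : A, bra x y = - bra y x)
    (hjacobi : ∀ x y z : A, bra x (bra y z) = bra (bra x y) z + bra y (bra x z))
    (hcompat : ∀ x y z : A, (2 : ℂ) • (z * bra x y) = bra (z * x) y + bra x (z * y)) :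
    ∀ x y : A, bra x y = 0 := by
  have key : ∀ z y : A, bra z y = (2 : ℂ) • (z * bra 1 y) - bra 1 (z * y) := by
    intro z y
    rw [hcompat 1 y z, mul_one]; abel
  have hleib : ∀ a b : A, bra 1 (a * b) = a • bra 1 b + b • bra 1 a := by
    intro a b
    have h := hanti a b
    rw [key a b, key b a, mul_comm b a] at h
    have h2 : (2 : ℂ) • bra 1 (a * b) = (2 : ℂ) • (a • bra 1 b + b • bra 1 a) := by
      simp only [smul_add, smul_eq_mul, two_smul] at h ⊢
      linear_combination -h
    exact smul_right_injective A (two_ne_zero (α := ℂ)) h2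
  have : IsReduced A := inferInstance
  have hD : ∀ a, bra 1 a = 0 := fun a => aux_der (Derivation.mk' (bra 1) hleib) a
  intro x y
  rw [key, hD, hD]; simp
end

section
/- Let (A, ·, [·,·]) be a unital transposed Poisson algebra over ℂ and set 𝔇(x) = [x, 1]. Then the quasi-Poisson identity holds: for all a, b, c ∈ A, a·(𝔇([b,c]) + [b,c]) = [a·(𝔇(b) + b), c] + [b, a·(𝔇(c) + c)] + [a,b]·(𝔇(c) + c) − (𝔇(b) + b)·[a,c]. -/
/-- Every unital transposed Poisson algebra over ℂ is a quasi-Poisson algebra with respect to the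
derivation `𝔇(x) = [x, 1]`. -/
theorem stmt_4 (A : Type*) [CommRing A] [Algebra ℂ A]
    (bra : A →ₗ[ℂ] A →ₗ[ℂ] A)
    (hanti : ∀ x y : A, bra x y = - bra y x)
    (hjacobi : ∀ x y z : A, bra x (bra y z) = bra (bra x y) z + bra y (bra x z))
    (hcompat : ∀ x y z : A, (2 : ℂ) • (z * bra x y) = bra (z * x) y + bra x (z * y)) :
    ∀ a b c : A,
      a * (bra (bra b c) 1 + bra b c) =
        bra (a * (bra b 1 + b)) c + bra b (a * (bra c 1 + c))
          + bra a b * (bra c 1 + c) - (bra b 1 + b) * bra a c := by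
  have h2 : ∀ x y : A, (2 : ℂ) • x = (2 : ℂ) • y → x = y := fun x y h => by
    have h' := congrArg (fun t => (2⁻¹ : ℂ) • t) h
    simpa [smul_smul] using h'
  have two : ∀ x : A, (2 : ℂ) • x = x + x := fun x => two_smul ℂ x
  have hb : ∀ x y : A, bra x y = y * bra x 1 - x * bra y 1 := fun x y => by
    apply h2
    have e1 := hcompat x 1 y
    have e2 := hcompat y 1 x
    rw [mul_one] at e1 e2
    rw [hanti y x, mul_comm x y] at e2
    rw [two] at e1 e2
    rw [two, two]
    linear_combination e2 - e1
  have hD : ∀ x y : A, bra (x * y) 1 = y * bra x 1 + x * bra y 1 := fun x y => by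
    have e1 := hcompat x 1 y
    rw [mul_one, two, hb x y, mul_comm y x] at e1
    linear_combination -e1
  intro a b c
  rw [hb b c, hb (a * (bra b 1 + b)) c, hb b (a * (bra c 1 + c)), hb a b, hb a c]
  simp only [hD, map_add, map_sub, LinearMap.add_apply, LinearMap.sub_apply]
  ring
end

section
/- Let (A, ·, [·,·]) be a unital transposed Poisson algebra over ℂ. Then it is a generalized Poisson algebra: for all x, y, z ∈ A, [x, y·z] = [x,y]·z + y·[x,z] − [x,1]·y·z. -/
/-- Every unital transposed Poisson algebra over ℂ is a generalized Poisson algebra: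
`[x, y·z] = [x,y]·z + y·[x,z] − [x,1]·y·z`. -/
theorem stmt_5 (A : Type*) [CommRing A] [Algebra ℂ A]
    (bra : A →ₗ[ℂ] A →ₗ[ℂ] A)
    (hanti : ∀ x y : A, bra x y = - bra y x)
    (hjacobi : ∀ x y z : A, bra x (bra y z) = bra (bra x y) z + bra y (bra x z))
    (hcompat : ∀ x y z : A, (2 : ℂ) • (z * bra x y) = bra (z * x) y + bra x (z * y)) :
    ∀ x y z : A, bra x (y * z) = bra x y * z + y * bra x z - bra x 1 * y * z := by
  have cancel : ∀ a b : A, (2 : ℂ) • a = (2 : ℂ) • b → a = b := fun a b h =>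
    smul_right_injective A (two_ne_zero : (2 : ℂ) ≠ 0) h
  have h1 : ∀ z y : A, bra z y = 2 * (z * bra 1 y) - bra 1 (z * y) := by
    intro z y
    have h := hcompat 1 y z
    rw [mul_one, two_smul] at h
    linear_combination -h
  have hd : ∀ z y : A, bra 1 (z * y) = z * bra 1 y + y * bra 1 z := by
    intro z y
    apply cancel
    rw [two_smul, two_smul]
    have h := hanti z y
    rw [h1 z y, h1 y z, mul_comm y z] at h
    linear_combination -h
  have hb : ∀ z y : A, bra z y = z * bra 1 y - y * bra 1 z := by
    intro z y
    rw [h1, hd]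
    ring
  intro x y z
  rw [hanti x 1, hb x (y * z), hb x y, hb x z, hd]
  ring
end

section
/- Let (A, ·, [·,·]) be a unital transposed Poisson algebra over ℂ. Then [·,·] is a Jordan bracket: for all x, y, z ∈ A, [x,[y,z]] = [[x,y],z] + [y,[x,z]] + [x,1]·[y,z] + [y,1]·[z,x] + [z,1]·[x,y]; equivalently, [x,1]·[y,z] + [y,1]·[z,x] + [z,1]·[x,y] = 0. -/
/-- In a unital transposed Poisson algebra over ℂ, the bracket is a Jordan bracket:
`[x,[y,z]] = [[x,y],z] + [y,[x,z]] + [x,1]·[y,z] + [y,1]·[z,x] + [z,1]·[x,y]`;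
equivalently `[x,1]·[y,z] + [y,1]·[z,x] + [z,1]·[x,y] = 0`. -/
theorem stmt_6 (A : Type*) [CommRing A] [Algebra ℂ A]
    (bra : A →ₗ[ℂ] A →ₗ[ℂ] A)
    (hanti : ∀ x y : A, bra x y = - bra y x)
    (hjacobi : ∀ x y z : A, bra x (bra y z) = bra (bra x y) z + bra y (bra x z))
    (hcompat : ∀ x y z : A, (2 : ℂ) • (z * bra x y) = bra (z * x) y + bra x (z * y)) :
    (∀ x y z : A,
      bra x (bra y z) = bra (bra x y) z + bra y (bra x z)
        + bra x 1 * bra y z + bra y 1 * bra z x + bra z 1 * bra x y) ∧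
    (∀ x y z : A,
      bra x 1 * bra y z + bra y 1 * bra z x + bra z 1 * bra x y = 0) := by
  have hb : ∀ x z : A, bra x z = z * bra x 1 - x * bra z 1 := by
    intro x z
    have h1 := hcompat x 1 z
    have h2 := hcompat z 1 x
    have h3 := hanti z x
    rw [two_smul, mul_one] at h1 h2
    rw [mul_comm x z] at h2
    have h4 : (2 : ℂ) • bra x z = (2 : ℂ) • (z * bra x 1 - x * bra z 1) := by
      rw [two_smul, two_smul]
      linear_combination h2 - h1 + h3
    exact (smul_right_injective A (two_ne_zero : (2 : ℂ) ≠ 0)) h4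
  have key : ∀ x y z : A,
      bra x 1 * bra y z + bra y 1 * bra z x + bra z 1 * bra x y = 0 := by
    intro x y z
    rw [hb y z, hb z x, hb x y]
    ring
  refine ⟨fun x y z => ?_, key⟩
  linear_combination hjacobi x y z - key x y z
end

section
/- Every transposed Poisson algebra (L, ·, [·,·]) over ℂ (not necessarily unital) satisfies the three identities of algebras of Jordan brackets: for all x, y, z, t ∈ L, (i) [[x,y]·z, t] + [[y,t]·z, x] + [[t,x]·z, y] = [x,y]·[z,t] + [y,t]·[z,x] + [t,x]·[z,y]; (ii) [y·t, z]·x + [x,z]·y·t = [t·x, z]·y + [y,z]·t·x; (iii) [t·x, y·z] + [t·y, x·z] + [x·y·z, t] = [t·y, z]·x + [t·x, z]·y + x·y·[z,t]. -/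
/-- Every (not necessarily unital) transposed Poisson algebra over ℂ satisfies the three
identities of algebras of Jordan brackets. -/
theorem stmt_7 (L : Type*) [AddCommGroup L] [Module ℂ L]
    (mul : L →ₗ[ℂ] L →ₗ[ℂ] L)
    (hcomm : ∀ x y : L, mul x y = mul y x)
    (hassoc : ∀ x y z : L, mul (mul x y) z = mul x (mul y z))
    (bra : L →ₗ[ℂ] L →ₗ[ℂ] L)
    (hanti : ∀ x y : L, bra x y = - bra y x)
    (hjacobi : ∀ x y z : L, bra x (bra y z) = bra (bra x y) z + bra y (bra x z))
    (hcompat : ∀ x y z : L, (2 : ℂ) • mul z (bra x y) = bra (mul z x) y + bra x (mul z y)) :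
    (∀ x y z t : L,
      bra (mul (bra x y) z) t + bra (mul (bra y t) z) x + bra (mul (bra t x) z) y =
        mul (bra x y) (bra z t) + mul (bra y t) (bra z x) + mul (bra t x) (bra z y)) ∧
    (∀ x y z t : L,
      mul (bra (mul y t) z) x + mul (mul (bra x z) y) t =
        mul (bra (mul t x) z) y + mul (mul (bra y z) t) x) ∧
    (∀ x y z t : L,
      bra (mul t x) (mul y z) + bra (mul t y) (mul x z) + bra (mul (mul x y) z) t =
        mul (bra (mul t y) z) x + mul (bra (mul t x) z) y + mul (mul x y) (bra z t)) := by
  have lc : ∀ x y z : L, mul x (mul y z) = mul y (mul x z) := fun x y z => by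
    rw [← hassoc, hcomm x y, hassoc]
  have h8 : ∀ x y z : L, mul x (bra y z) + mul y (bra z x) + mul z (bra x y) = 0 := by
    intro x y z
    have e1 := hcompat y z x
    have e2 := hcompat z x y
    have e3 := hcompat x y z
    rw [hanti y (mul x z), hcomm x z] at e1
    rw [hanti z (mul y x), hcomm y x] at e2
    rw [hanti x (mul z y), hcomm z y] at e3
    linear_combination (norm := module) (1/2 : ℂ) • e1 + (1/2 : ℂ) • e2 + (1/2 : ℂ) • e3
  have h9 : ∀ h x y z : L, bra (mul h (bra x y)) z + bra (mul h (bra y z)) x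
      + bra (mul h (bra z x)) y = 0 := by
    intro h x y z
    have j : ∀ a b c : L, bra a (bra b c) = bra (bra a b) c + bra (bra c a) b := by
      intro a b c
      rw [hjacobi a b c, hanti b (bra a c), hanti a c]; simp
    have c : ∀ a b c : L, (2 : ℂ) • bra (mul h (bra a b)) c
        = bra (bra (mul h a) b) c + bra (bra a (mul h b)) c := by
      intro a b c
      rw [← LinearMap.smul_apply, ← map_smul, hcompat]; simp
    have d : ∀ a b c : L, (2 : ℂ) • mul h (bra (bra a b) c)
        = bra (mul h (bra a b)) c - bra (mul h c) (bra a b) := by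
      intro a b c
      rw [hcompat, hanti (bra a b) (mul h c)]; abel
    have jz : mul h (bra (bra x y) z) + mul h (bra (bra y z) x) + mul h (bra (bra z x) y) = 0 := by
      rw [← map_add, ← map_add, add_assoc, hanti (bra y z) x, j x y z, ]
      simp
    linear_combination (norm := module) c x y z + c y z x + c z x y + d x y z + d y z x + d z x y
      - (2 : ℂ) • jz - j (mul h x) y z - j (mul h y) z x - j (mul h z) x y
  have h11 : ∀ h x y z : L, mul (bra h x) (bra y z) + mul (bra h y) (bra z x)
      + mul (bra h z) (bra x y) = 0 := by
    intro h x y z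
    have c : ∀ a b c : L, (2 : ℂ) • mul (bra h a) (bra b c)
        = bra (mul b (bra h a)) c + bra (mul c (bra a h)) b := by
      intro a b c
      rw [hcompat, hanti b, hcomm _ b, hcomm _ c, hanti h a]; simp
    have e := congrArg (fun w => bra w h) (h8 x y z)
    simp only [map_add, LinearMap.add_apply, map_zero, LinearMap.zero_apply] at e
    have n : ∀ a b c d : L, bra (mul a (bra b c)) d = - bra (mul a (bra c b)) d := by
      intro a b c d
      rw [hanti b c]; simp
    linear_combination (norm := module) (1/2 : ℂ) • (c x y z + c y z x + c z x y + h9 y h x z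
      + h9 z h y x + h9 x h z y + e - n y x z h - n z y x h - n x z y h)
  have hK : ∀ x y u v : L, bra (mul u x) (mul v y) + bra (mul v x) (mul u y)
      = (2 : ℂ) • mul u (mul v (bra x y)) := by
    intro x y u v
    have e1 := congrArg (mul u) (hcompat x y v)
    have e2 := hcompat (mul v x) y u
    have e3 := hcompat x (mul v y) u
    have e4 := hcompat x y (mul u v)
    simp only [map_smul, map_add, hassoc] at e1 e2 e3 e4
    linear_combination (norm := module) (-2 : ℂ) • e1 - e2 - e3 + e4
  refine ⟨?_, ?_, ?_⟩
  · intro x y z t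
    have e1 := h9 z x y t
    have e2 := h11 z x y t
    rw [hcomm _ z, hcomm _ z, hcomm _ z, e1, hcomm (bra x y), hcomm (bra y t), hcomm (bra t x)]
    linear_combination (norm := module) -e2
  · intro x y z t
    have a1 := hcompat (mul y t) z x
    have a2 := hcompat x z (mul y t)
    have a3 := hcompat (mul t x) z y
    have a4 := hcompat y z (mul t x)
    have k := hK x y t z
    have a5 := hcompat x y (mul t z)
    have n4 := hanti y (mul (mul t z) x)
    have n5 := hanti (mul t y) (mul z x)
    simp only [hassoc, hcomm, lc] at a1 a2 a3 a4 a5 k n4 n5 ⊢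
    linear_combination (norm := module) (1/2 : ℂ) • (a1 + a2 - a3 - a4 - k - a5 + n5 - n4)
  · intro x y z t
    have a1 := hcompat (mul t y) z x
    have a2 := hcompat (mul t x) z y
    have a3 := hcompat z t (mul x y)
    have k := hK t z x y
    have a4 := hcompat t z (mul x y)
    have n1 := hanti z (mul x (mul y t))
    have n2 := hanti t (mul x (mul y z))
    have n3 : mul x (mul y (bra z t)) = - mul x (mul y (bra t z)) := by
      rw [hanti z t]; simp
    simp only [hassoc, hcomm, lc] at a1 a2 a3 a4 k n1 n2 n3 ⊢
    linear_combination (norm := module) (1/2 : ℂ) • (k + a4 + n2 - n1 - a1 - a2 - a3)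
end

section
/- Let (L, ·, [·,·]) be a unital transposed Poisson algebra over ℂ such that (L, ·) is an integral domain, and let Q(L) be the field of fractions of (L, ·) with canonical embedding ι : L → Q(L). Then there exists a ℂ-bilinear Lie bracket ⟦·,·⟧ on Q(L) such that (Q(L), ·, ⟦·,·⟧) is a (unital) transposed Poisson algebra with respect to the field multiplication of Q(L), and for all a, b, c, d ∈ L with b ≠ 0, d ≠ 0 one has ⟦ι(a)/ι(b), ι(c)/ι(d)⟧ = ι([a,b]·c·d − a·b·[c,d]) / ι(b²·d²); in particular ⟦ι(a), ι(c)⟧ = ι([a,c]) for all a, c ∈ L. -/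
/-- Extension of a `ℂ`-linear derivation to the field of fractions. -/
theorem exists_der_ext (L : Type*) [CommRing L] [IsDomain L] [Algebra ℂ L]
    (K : Type*) [Field K] [Algebra L K] [IsFractionRing L K]
    [Algebra ℂ K] [IsScalarTower ℂ L K] (D : L →ₗ[ℂ] L)
    (hD : ∀ x y, D (x * y) = x * D y + y * D x) :
    ∃ E : K →ₗ[ℂ] K, (∀ p q, E (p * q) = p * E q + q * E p) ∧
      ∀ a, E (algebraMap L K a) = algebraMap L K (D a) := by
  have h1 : D 1 = 0 := by
    have := hD 1 1
    simp only [mul_one, one_mul] at this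
    simpa using this
  let f : L →+* TrivSqZeroExt K K :=
    { toFun := fun a => TrivSqZeroExt.inl (algebraMap L K a) +
        TrivSqZeroExt.inr (algebraMap L K (D a))
      map_one' := by ext <;> simp [h1]
      map_zero' := by ext <;> simp
      map_add' := fun x y => by ext <;> simp [Algebra.smul_def]
      map_mul' := fun x y => by
        ext
        · simp
        · simp only [hD, TrivSqZeroExt.snd_mul, TrivSqZeroExt.snd_add, TrivSqZeroExt.fst_add,
            TrivSqZeroExt.snd_inl, TrivSqZeroExt.snd_inr, TrivSqZeroExt.fst_inl,
            TrivSqZeroExt.fst_inr, zero_add, add_zero, smul_eq_mul, MulOpposite.smul_eq_mul_unop,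
            MulOpposite.unop_op, map_add, map_mul]
          ring }
  have hf1 : ∀ a, (f a).fst = algebraMap L K a := fun a => by simp [f]
  have hf2 : ∀ a, (f a).snd = algebraMap L K (D a) := fun a => by
    change (TrivSqZeroExt.inl (algebraMap L K a) +
      TrivSqZeroExt.inr (algebraMap L K (D a)) : TrivSqZeroExt K K).snd = _
    rw [TrivSqZeroExt.snd_add, TrivSqZeroExt.snd_inl, TrivSqZeroExt.snd_inr, zero_add]
  have hu : ∀ y : nonZeroDivisors L, IsUnit (f y) := fun y => by
    rw [TrivSqZeroExt.isUnit_iff_isUnit_fst, hf1]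
    exact IsLocalization.map_units K y
  let F : K →+* TrivSqZeroExt K K := IsLocalization.lift hu
  have hF : ∀ a, F (algebraMap L K a) = f a := fun a => IsLocalization.lift_eq hu a
  have hfst : ∀ p, (F p).fst = p := by
    have : ((TrivSqZeroExt.fstHom K K K).toRingHom.comp F) = RingHom.id K := by
      apply IsLocalization.ringHom_ext (nonZeroDivisors L)
      ext a
      simp [hF, hf1]
    intro p
    exact congrArg (fun g : K →+* K => g p) this
  have hmul : ∀ p q, (F (p * q)).snd = p * (F q).snd + q * (F p).snd := fun p q => by
    rw [map_mul, TrivSqZeroExt.snd_mul, hfst, hfst]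
    simp [mul_comm]
  have hc : ∀ c : ℂ, (F (algebraMap ℂ K c)).snd = 0 := fun c => by
    rw [IsScalarTower.algebraMap_apply ℂ L K, hF, hf2,
      Algebra.algebraMap_eq_smul_one (A := L) c, map_smul, h1]
    simp
  refine ⟨{ toFun := fun p => (F p).snd, map_add' := fun p q => by simp,
            map_smul' := fun c p => ?_ }, hmul, fun a => ?_⟩
  · rw [Algebra.smul_def, hmul, hc, RingHom.id_apply, Algebra.smul_def]
    simp
  · change (F (algebraMap L K a)).snd = _
    rw [hF, hf2]

/-- The bracket of a unital transposed Poisson algebra whose associative part is an integral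
domain extends to its field of fractions, yielding a transposed Poisson field with
`⟦a/b, c/d⟧ = ([a,b]·c·d − a·b·[c,d]) / (b²·d²)`. -/
theorem stmt_9 (L : Type*) [CommRing L] [IsDomain L] [Algebra ℂ L]
    (K : Type*) [Field K] [Algebra L K] [IsFractionRing L K]
    [Algebra ℂ K] [IsScalarTower ℂ L K]
    (bra : L →ₗ[ℂ] L →ₗ[ℂ] L)
    (hanti : ∀ x y : L, bra x y = - bra y x)
    (hjacobi : ∀ x y z : L, bra x (bra y z) = bra (bra x y) z + bra y (bra x z))
    (hcompat : ∀ x y z : L, (2 : ℂ) • (z * bra x y) = bra (z * x) y + bra x (z * y)) :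
    ∃ bra' : K →ₗ[ℂ] K →ₗ[ℂ] K,
      (∀ p q : K, bra' p q = - bra' q p) ∧
      (∀ p q r : K, bra' p (bra' q r) = bra' (bra' p q) r + bra' q (bra' p r)) ∧
      (∀ p q r : K, (2 : ℂ) • (r * bra' p q) = bra' (r * p) q + bra' p (r * q)) ∧
      (∀ a b c d : L, b ≠ 0 → d ≠ 0 →
        bra' (algebraMap L K a / algebraMap L K b) (algebraMap L K c / algebraMap L K d) =
          algebraMap L K (bra a b * c * d - a * b * bra c d)
            / algebraMap L K (b ^ 2 * d ^ 2)) ∧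
      (∀ a c : L, bra' (algebraMap L K a) (algebraMap L K c) = algebraMap L K (bra a c)) := by
  have e1 : ∀ z y, bra z y = 2 * (z * bra 1 y) - bra 1 (z * y) := fun z y => by
    have := hcompat 1 y z
    rw [two_smul, mul_one] at this
    linear_combination -this
  have hD : ∀ x y, bra 1 (x * y) = x * bra 1 y + y * bra 1 x := fun x y => by
    have h := hanti x y
    rw [e1 x y, e1 y x, mul_comm y x] at h
    have h2 : (2 : ℂ) • (bra 1 (x * y) - (x * bra 1 y + y * bra 1 x)) = 0 := by
      rw [two_smul]
      linear_combination -h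
    rcases smul_eq_zero.mp h2 with h3 | h3
    · norm_num at h3
    · exact sub_eq_zero.mp h3
  have hb : ∀ x y, bra x y = x * bra 1 y - y * bra 1 x := fun x y => by
    rw [e1, hD]; ring
  obtain ⟨E, hE, hEL⟩ := exists_der_ext L K (bra 1) hD
  let bra' : K →ₗ[ℂ] K →ₗ[ℂ] K := LinearMap.mk₂ ℂ (fun p q => p * E q - q * E p)
    (fun p p' q => by simp only [map_add]; ring)
    (fun c p q => by rw [map_smul]; simp only [Algebra.smul_def]; ring)
    (fun p q q' => by simp only [map_add]; ring)
    (fun c p q => by rw [map_smul]; simp only [Algebra.smul_def]; ring)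
  have hb' : ∀ p q, bra' p q = p * E q - q * E p := fun p q => rfl
  have hdiv : ∀ a b : L, b ≠ 0 → E (algebraMap L K a / algebraMap L K b) =
      algebraMap L K (b * bra 1 a - a * bra 1 b) / algebraMap L K (b ^ 2) := fun a b hb0 => by
    have hbK : algebraMap L K b ≠ 0 := by
      simpa using hb0
    have h := hE (algebraMap L K a / algebraMap L K b) (algebraMap L K b)
    rw [div_mul_cancel₀ _ hbK, hEL, hEL] at h
    simp only [map_sub, map_mul, map_pow]
    rw [h]
    field_simp
    ring
  refine ⟨bra', fun p q => ?_, fun p q r => ?_, fun p q r => ?_, fun a b c d hb0 hd0 => ?_,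
    fun a c => ?_⟩
  · simp only [hb']; ring
  · rw [hb' q r, hb' p q, hb' p r]
    simp only [hb']
    simp only [map_sub, hE]; ring
  · simp only [hb', hE, two_smul]; ring
  · have hbK : algebraMap L K b ≠ 0 := by
      simpa using hb0
    have hdK : algebraMap L K d ≠ 0 := by
      simpa using hd0
    rw [hb', hdiv a b hb0, hdiv c d hd0, hb a b, hb c d]
    simp only [map_sub, map_mul, map_pow]
    field_simp
    ring
  · rw [hb', hEL, hEL, hb a c]
    simp only [map_sub, map_mul]
end

section
/- Let n ≥ 2, let L be a complex vector space equipped with a commutative ℂ-bilinear multiplication ·, and let [·,…,·] : Lⁿ → L be an alternating ℂ-multilinear map. Then the following are equivalent: (1) both compatibility conditions hold, namely the Poisson n-Leibniz rule [x·y, z₂, …, z_n] = x·[y, z₂, …, z_n] + [x, z₂, …, z_n]·y for all x, y, z₂, …, z_n ∈ L, and the transposed condition n·(z·[x₁, …, x_n]) = Σ_{i=1}^{n} [x₁, …, z·x_i, …, x_n] for all z, x₁, …, x_n ∈ L; (2) x·[y₁, …, y_n] = 0 and [x·y₁, y₂, …, y_n] = 0 for all x, y₁, …, y_n ∈ L.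 -/
theorem slot_aux {n : ℕ} {L : Type*} [AddCommGroup L] [Module ℂ L]
    (bra : AlternatingMap ℂ L L (Fin n)) (o i : Fin n) (v : Fin n → L) :
    ∃ (c : ℂ) (w : Fin n → L), ∀ a,
      bra (Function.update v i a) = c • bra (Function.update w o a) := by
  by_cases h : o = i
  · subst h
    exact ⟨1, v, fun a => by simp⟩
  · refine ⟨-1, v ∘ Equiv.swap o i, fun a => ?_⟩
    have h1 := bra.map_swap (Function.update v i a) h
    have h2 : (Function.update v i a) ∘ Equiv.swap o i
        = Function.update (v ∘ Equiv.swap o i) o a := by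
      rw [Function.update_comp_equiv]
      simp
    rw [h2] at h1
    rw [h1]
    simp

/-- For `n ≥ 2`, a commutative bilinear multiplication and an alternating `n`-linear bracket on a
complex vector space satisfy both the Poisson `n`-Leibniz rule and the transposed Poisson
compatibility condition if and only if `x·[y₁,…,y_n] = 0` and `[x·y₁, y₂, …, y_n] = 0` always. -/
theorem stmt_11 (n : ℕ) (hn : 2 ≤ n) (L : Type*) [AddCommGroup L] [Module ℂ L]
    (mul : L →ₗ[ℂ] L →ₗ[ℂ] L)
    (hcomm : ∀ x y : L, mul x y = mul y x)
    (bra : AlternatingMap ℂ L L (Fin n)) :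
    ((∀ (x y : L) (v : Fin n → L),
        bra (Function.update v ⟨0, by omega⟩ (mul x y)) =
          mul x (bra (Function.update v ⟨0, by omega⟩ y))
            + mul (bra (Function.update v ⟨0, by omega⟩ x)) y) ∧
      (∀ (z : L) (v : Fin n → L),
        (n : ℂ) • mul z (bra v) = ∑ i : Fin n, bra (Function.update v i (mul z (v i))))) ↔
    ((∀ (x : L) (v : Fin n → L), mul x (bra v) = 0) ∧
      (∀ (x y : L) (v : Fin n → L), bra (Function.update v ⟨0, by omega⟩ (mul x y)) = 0)) := by
  obtain ⟨o, ho⟩ : ∃ o : Fin n, o = ⟨0, by omega⟩ := ⟨_, rfl⟩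
  rw [← ho]
  have hn0 : (n : ℂ) ≠ 0 := by
    have : n ≠ 0 := by omega
    exact_mod_cast this
  constructor
  · rintro ⟨hL, hT⟩
    have hLi : ∀ (i : Fin n) (x y : L) (v : Fin n → L),
        bra (Function.update v i (mul x y)) =
          mul x (bra (Function.update v i y)) + mul y (bra (Function.update v i x)) := by
      intro i x y v
      obtain ⟨c, w, hw⟩ := slot_aux bra o i v
      rw [hw, hw, hw, hL, hcomm _ y]
      simp
    have hA : ∀ (z : L) (v : Fin n → L),
        ∑ i : Fin n, mul (v i) (bra (Function.update v i z)) = 0 := by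
      intro z v
      have h := hT z v
      simp only [hLi, Function.update_eq_self, Finset.sum_add_distrib, Finset.sum_const,
        Finset.card_univ, Fintype.card_fin] at h
      rw [← Nat.cast_smul_eq_nsmul ℂ] at h
      exact left_eq_add.mp h
    have hB : ∀ (z : L) (v : Fin n → L) (k : Fin n),
        mul z (bra v) + mul (v k) (bra (Function.update v k z)) = 0 := by
      intro z v k
      have h1 := hA (v k) (Function.update v k z)
      have h2 := hA z v
      rw [← Finset.add_sum_erase _ _ (Finset.mem_univ k)] at h1 h2
      have h3 : ∑ i ∈ Finset.univ.erase k, mul (Function.update v k z i)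
            (bra (Function.update (Function.update v k z) i (v k)))
          = - ∑ i ∈ Finset.univ.erase k, mul (v i) (bra (Function.update v i z)) := by
        rw [← Finset.sum_neg_distrib]
        refine Finset.sum_congr rfl fun i hi => ?_
        have hik : i ≠ k := Finset.ne_of_mem_erase hi
        have h4 : Function.update (Function.update v k z) i (v k)
            = (Function.update v i z) ∘ Equiv.swap i k := by
          funext j
          by_cases hji : j = i
          · subst hji
            simp [hik.symm]
          · by_cases hjk : j = k
            · subst hjk
              simp [hik.symm]
            · simp [hji, hjk, Equiv.swap_apply_of_ne_of_ne hji hjk]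
        rw [h4, bra.map_swap _ hik]
        simp [hik]
      rw [h3] at h1
      simp only [Function.update_self, Function.update_idem, Function.update_eq_self] at h1
      have h5 := congrArg₂ (· + ·) h1 h2
      simp only [add_zero] at h5
      rw [← h5]
      abel
    have hF : ∀ (x : L) (v : Fin n → L), mul x (bra v) = 0 := by
      intro x v
      have h := Finset.sum_eq_zero (s := Finset.univ) fun k _ => hB x v k
      rw [Finset.sum_add_distrib, hA, add_zero, Finset.sum_const, Finset.card_univ,
        Fintype.card_fin, ← Nat.cast_smul_eq_nsmul ℂ] at h
      exact (smul_eq_zero.mp h).resolve_left hn0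
    refine ⟨hF, fun x y v => ?_⟩
    rw [hLi, hF, hF, add_zero]
  · rintro ⟨hF, hG⟩
    refine ⟨fun x y v => ?_, fun z v => ?_⟩
    · rw [hG, hF, hcomm, hF, add_zero]
    · rw [hF, smul_zero, Finset.sum_eq_zero]
      intro i _
      obtain ⟨c, w, hw⟩ := slot_aux bra o i v
      rw [hw, hG, smul_zero]
end

section
/- Let (L, [·,·]) be a complex Lie algebra whose Lie bracket is not identically zero, and suppose that every Hom-Lie structure on L is trivial, i.e. every ℂ-linear map φ : L → L satisfying [φ(x), [y,z]] + [φ(y), [z,x]] + [φ(z), [x,y]] = 0 for all x, y, z ∈ L is a scalar multiple of the identity. Then every transposed Poisson structure on L is trivial: every commutative associative ℂ-bilinear multiplication · on L satisfying 2 z·[x,y] = [z·x, y] + [x, z·y] for all x, y, z ∈ L is identically zero. -/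
/-- If every Hom-Lie structure on a complex Lie algebra `L` with nonzero bracket is a scalar
multiple of the identity, then every transposed Poisson structure on `L` is trivial. -/
theorem stmt_18 (L : Type*) [LieRing L] [LieAlgebra ℂ L]
    (hbracket : ∃ x y : L, ⁅x, y⁆ ≠ 0)
    (hhom : ∀ φ : L →ₗ[ℂ] L,
      (∀ x y z : L, ⁅φ x, ⁅y, z⁆⁆ + ⁅φ y, ⁅z, x⁆⁆ + ⁅φ z, ⁅x, y⁆⁆ = 0) →
      ∃ c : ℂ, φ = c • (LinearMap.id : L →ₗ[ℂ] L))
    (mul : L →ₗ[ℂ] L →ₗ[ℂ] L)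
    (hcomm : ∀ x y : L, mul x y = mul y x)
    (hassoc : ∀ x y z : L, mul (mul x y) z = mul x (mul y z))
    (hcompat : ∀ x y z : L, (2 : ℂ) • mul z ⁅x, y⁆ = ⁅mul z x, y⁆ + ⁅x, mul z y⁆) :
    ∀ x y : L, mul x y = 0 := by
  have hA : ∀ w : L, ∃ c : ℂ, ∀ z, mul w z = c • z := by
    intro w
    obtain ⟨c, hc⟩ := hhom (mul w) (by
      intro x y z
      have h2 : ∀ x y z : L, (2 : ℂ) • ⁅x, mul w ⁅y, z⁆⁆
          = ⁅x, ⁅mul w y, z⁆⁆ + ⁅x, ⁅y, mul w z⁆⁆ := by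
        intro x y z
        rw [← lie_smul, hcompat, lie_add]
      have hF : mul w ⁅x, ⁅y, z⁆⁆ + mul w ⁅y, ⁅z, x⁆⁆ + mul w ⁅z, ⁅x, y⁆⁆ = 0 := by
        rw [← map_add, ← map_add, lie_jacobi, map_zero]
      linear_combination (norm := module) (-2 : ℂ) • (hcompat x ⁅y, z⁆ w) + (-2 : ℂ) • (hcompat y ⁅z, x⁆ w)
        + (-2 : ℂ) • (hcompat z ⁅x, y⁆ w) - h2 x y z - h2 y z x - h2 z x y
        - lie_jacobi (mul w x) y z - lie_jacobi x (mul w y) z - lie_jacobi x y (mul w z)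
        + (4 : ℂ) • hF)
    exact ⟨c, fun z => by simp [hc]⟩
  intro w v
  obtain ⟨c, hc⟩ := hA w
  by_cases h0 : c = 0
  · simp [hc, h0]
  exfalso
  have hm : ∀ z : L, ∃ d : ℂ, z = d • w := by
    intro z
    obtain ⟨d, hd⟩ := hA z
    refine ⟨c⁻¹ * d, ?_⟩
    rw [mul_smul, ← hd w, hcomm z w, hc, smul_smul, inv_mul_cancel₀ h0, one_smul]
  obtain ⟨x, y, hxy⟩ := hbracket
  obtain ⟨a, rfl⟩ := hm x
  obtain ⟨b, rfl⟩ := hm y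
  exact hxy (by simp)
end
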